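/- arXiv:2312.03930 — 2 statements merged into one kernel-verified Lean document; each statement's English description precedes it below -/
import Mathlib

section
/- (Preconditioned condition number bound (43).) Let P and G̃ be invertible N × N real matrices and set E := P − G̃. Then the condition number of P^{-1}G̃ in the ∞-operator norm satisfies κ_∞(P^{-1} G̃) ≤ 1 + (‖G̃^{-1}‖_∞ + ‖P^{-1}‖_∞)·‖E‖_∞ + ‖G̃^{-1}‖_∞ · ‖P^{-1}‖_∞ · ‖E‖_∞². -/
/-- The `∞`-operator norm of a real `N × N` matrix: the maximum row sum of
absolute values. -/
noncomputable def normInf {N : ℕ} (A : Matrix (Fin N) (Fin N) ℝ) : ℝ :=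
  ⨆ i : Fin N, ∑ j, |A i j|

/-- The `∞`-norm condition number `κ_∞(A) = ‖A‖_∞ ‖A⁻¹‖_∞`. -/
noncomputable def condInf {N : ℕ} (A : Matrix (Fin N) (Fin N) ℝ) : ℝ :=
  normInf A * normInf A⁻¹

theorem sum_abs_le_normInf {N : ℕ} (A : Matrix (Fin N) (Fin N) ℝ) (i : Fin N) :
    ∑ j, |A i j| ≤ normInf A :=
  le_ciSup (f := fun i => ∑ j, |A i j|) (Set.finite_range _).bddAbove i

theorem normInf_nonneg {N : ℕ} (A : Matrix (Fin N) (Fin N) ℝ) : 0 ≤ normInf A :=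
  Real.iSup_nonneg fun _ => Finset.sum_nonneg fun _ _ => abs_nonneg _

theorem normInf_one_le {N : ℕ} : normInf (1 : Matrix (Fin N) (Fin N) ℝ) ≤ 1 :=
  Real.iSup_le (fun i => by simp [Matrix.one_apply, apply_ite abs]) zero_le_one

theorem normInf_add_le {N : ℕ} (A B : Matrix (Fin N) (Fin N) ℝ) :
    normInf (A + B) ≤ normInf A + normInf B := by
  refine Real.iSup_le (fun i => ?_) (add_nonneg (normInf_nonneg A) (normInf_nonneg B))
  calc ∑ j, |(A + B) i j| ≤ ∑ j, (|A i j| + |B i j|) :=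
        Finset.sum_le_sum fun j _ => abs_add_le _ _
    _ = ∑ j, |A i j| + ∑ j, |B i j| := Finset.sum_add_distrib
    _ ≤ normInf A + normInf B :=
        add_le_add (sum_abs_le_normInf A i) (sum_abs_le_normInf B i)

theorem normInf_neg {N : ℕ} (A : Matrix (Fin N) (Fin N) ℝ) : normInf (-A) = normInf A := by
  simp [normInf]

theorem normInf_mul_le {N : ℕ} (A B : Matrix (Fin N) (Fin N) ℝ) :
    normInf (A * B) ≤ normInf A * normInf B := by
  refine Real.iSup_le (fun i => ?_) (mul_nonneg (normInf_nonneg A) (normInf_nonneg B))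
  calc ∑ j, |(A * B) i j| ≤ ∑ j, ∑ k, |A i k| * |B k j| :=
        Finset.sum_le_sum fun j _ => by
          simpa only [Matrix.mul_apply, abs_mul] using
            Finset.abs_sum_le_sum_abs (fun k => A i k * B k j) Finset.univ
    _ = ∑ k, |A i k| * ∑ j, |B k j| := by
        rw [Finset.sum_comm]
        simp only [Finset.mul_sum]
    _ ≤ ∑ k, |A i k| * normInf B :=
        Finset.sum_le_sum fun k _ =>
          mul_le_mul_of_nonneg_left (sum_abs_le_normInf B k) (abs_nonneg _)
    _ = (∑ k, |A i k|) * normInf B := (Finset.sum_mul ..).symm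
    _ ≤ normInf A * normInf B :=
        mul_le_mul_of_nonneg_right (sum_abs_le_normInf A i) (normInf_nonneg B)

theorem normInf_one_add_mul_le {N : ℕ} (A B : Matrix (Fin N) (Fin N) ℝ) :
    normInf (1 + A * B) ≤ 1 + normInf A * normInf B :=
  (normInf_add_le _ _).trans (add_le_add normInf_one_le (normInf_mul_le A B))

/-- Preconditioned condition number bound (43): with `E := P − G̃`,
`κ_∞(P⁻¹G̃) ≤ 1 + (‖G̃⁻¹‖_∞ + ‖P⁻¹‖_∞)‖E‖_∞ + ‖G̃⁻¹‖_∞ ‖P⁻¹‖_∞ ‖E‖_∞²`. -/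
theorem preconditioned_cond_bound {N : ℕ}
    (P Gt : Matrix (Fin N) (Fin N) ℝ) (hP : IsUnit P) (hG : IsUnit Gt) :
    condInf (P⁻¹ * Gt) ≤
      1 + (normInf Gt⁻¹ + normInf P⁻¹) * normInf (P - Gt) +
        normInf Gt⁻¹ * normInf P⁻¹ * normInf (P - Gt) ^ 2 := by
  have hPd := (Matrix.isUnit_iff_isUnit_det P).mp hP
  have hGd := (Matrix.isUnit_iff_isUnit_det Gt).mp hG
  have hfwd : P⁻¹ * Gt = 1 + P⁻¹ * -(P - Gt) := by
    rw [neg_sub, mul_sub, Matrix.nonsing_inv_mul P hPd]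
    abel
  have hinv : (P⁻¹ * Gt)⁻¹ = 1 + Gt⁻¹ * (P - Gt) := by
    rw [Matrix.mul_inv_rev, Matrix.nonsing_inv_nonsing_inv P hPd, mul_sub,
      Matrix.nonsing_inv_mul Gt hGd]
    abel
  have hP_le := normInf_one_add_mul_le P⁻¹ (-(P - Gt))
  rw [← hfwd, normInf_neg] at hP_le
  have hG_le := normInf_one_add_mul_le Gt⁻¹ (P - Gt)
  rw [← hinv] at hG_le
  calc condInf (P⁻¹ * Gt)
      ≤ (1 + normInf P⁻¹ * normInf (P - Gt)) * (1 + normInf Gt⁻¹ * normInf (P - Gt)) :=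
        mul_le_mul hP_le hG_le (normInf_nonneg _) ((normInf_nonneg _).trans hP_le)
    _ = _ := by ring
end

section
/- (Truncated preconditioned condition number bound, precise form of (47).) Let P, G̃ and T be invertible N × N real matrices and set E := P − G̃. Then the matrix (T P^{-1}) G̃ is invertible and κ_∞((T P^{-1}) G̃) ≤ ‖T‖_∞ · ‖T^{-1}‖_∞ · (1 + ‖P^{-1}‖_∞ ‖E‖_∞) · (1 + ‖G̃^{-1}‖_∞ ‖E‖_∞). -/
/-- A left multiplication `A⁻¹ * B` is a perturbation of the identity by `A⁻¹ * (B - A)`. -/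
theorem normInf_inv_mul_le {N : ℕ} {A : Matrix (Fin N) (Fin N) ℝ} (hA : IsUnit A)
    (B : Matrix (Fin N) (Fin N) ℝ) :
    normInf (A⁻¹ * B) ≤ 1 + normInf A⁻¹ * normInf (B - A) := by
  have h : A⁻¹ * B = 1 + A⁻¹ * (B - A) := by
    rw [mul_sub, Matrix.nonsing_inv_mul A ((Matrix.isUnit_iff_isUnit_det A).mp hA),
      add_sub_cancel]
  rw [h]
  refine (normInf_add_le _ _).trans ?_
  exact add_le_add normInf_one_le (normInf_mul_le _ _)

/-- Truncated preconditioned condition number bound (47), precise form: for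
invertible `P`, `G̃`, `T` and `E := P − G̃`, the matrix `(T P⁻¹) G̃` is invertible and
`κ_∞((TP⁻¹)G̃) ≤ ‖T‖_∞‖T⁻¹‖_∞ (1 + ‖P⁻¹‖_∞‖E‖_∞)(1 + ‖G̃⁻¹‖_∞‖E‖_∞)`. -/
theorem truncated_preconditioned_cond_bound {N : ℕ}
    (P Gt T : Matrix (Fin N) (Fin N) ℝ)
    (hP : IsUnit P) (hG : IsUnit Gt) (hT : IsUnit T) :
    IsUnit ((T * P⁻¹) * Gt) ∧
    condInf ((T * P⁻¹) * Gt) ≤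
      normInf T * normInf T⁻¹ * (1 + normInf P⁻¹ * normInf (P - Gt)) *
        (1 + normInf Gt⁻¹ * normInf (P - Gt)) := by
  refine ⟨(hT.mul ((Matrix.isUnit_nonsing_inv_iff).mpr hP)).mul hG, ?_⟩
  have hinv : (T * P⁻¹ * Gt)⁻¹ = Gt⁻¹ * P * T⁻¹ := by
    rw [Matrix.mul_inv_rev, Matrix.mul_inv_rev,
      Matrix.nonsing_inv_nonsing_inv P ((Matrix.isUnit_iff_isUnit_det P).mp hP), mul_assoc]
  have hPG : normInf (P⁻¹ * Gt) ≤ 1 + normInf P⁻¹ * normInf (P - Gt) := by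
    rw [← normInf_neg (P - Gt), neg_sub]
    exact normInf_inv_mul_le hP Gt
  have hGP := normInf_inv_mul_le hG P
  have hM : normInf (T * P⁻¹ * Gt) ≤
      normInf T * (1 + normInf P⁻¹ * normInf (P - Gt)) := by
    rw [mul_assoc]
    exact (normInf_mul_le _ _).trans (mul_le_mul_of_nonneg_left hPG (normInf_nonneg T))
  have hMinv : normInf (Gt⁻¹ * P * T⁻¹) ≤
      (1 + normInf Gt⁻¹ * normInf (P - Gt)) * normInf T⁻¹ :=
    (normInf_mul_le _ _).trans (mul_le_mul_of_nonneg_right hGP (normInf_nonneg T⁻¹))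
  rw [condInf, hinv]
  calc _ ≤ _ := mul_le_mul hM hMinv (normInf_nonneg _) ((normInf_nonneg _).trans hM)
    _ = _ := by ring
end
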